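/- arXiv:2212.09427 — 6 statements merged into one kernel-verified Lean document; each statement's English description precedes it below -/
import Mathlib

section
/- In the canonical cosymplectic model, let H and f₁, …, f_r be twice continuously differentiable functions on M such that each fᵢ is a first integral of the evaluation vector field Y_H and {fᵢ, fⱼ} = 0 identically for all i, j. Then the vector fields Y_H, X_{f₁}, …, X_{f_r} pairwise commute: [Y_H, X_{fᵢ}] = 0 and [X_{fᵢ}, X_{fⱼ}] = 0 identically on M for all i, j. -/
open RealInnerProductSpace

noncomputable section

abbrev E (n : ℕ) : Type := EuclideanSpace ℝ (Fin n)

abbrev M (n : ℕ) : Type := ℝ × E n × E n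

/-- Partial derivative of `f` in the first (time) factor. -/
noncomputable def dt (n : ℕ) (f : M n → ℝ) (x : M n) : ℝ :=
  fderiv ℝ f x (1, 0, 0)

/-- Gradient of `f` in the second (`q`) factor. -/
noncomputable def gradQ (n : ℕ) (f : M n → ℝ) (x : M n) : E n :=
  (InnerProductSpace.toDual ℝ (E n)).symm
    ((fderiv ℝ f x).comp ((ContinuousLinearMap.inr ℝ ℝ (E n × E n)).comp
      (ContinuousLinearMap.inl ℝ (E n) (E n))))

/-- Gradient of `f` in the third (`p`) factor. -/
noncomputable def gradP (n : ℕ) (f : M n → ℝ) (x : M n) : E n :=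
  (InnerProductSpace.toDual ℝ (E n)).symm
    ((fderiv ℝ f x).comp ((ContinuousLinearMap.inr ℝ ℝ (E n × E n)).comp
      (ContinuousLinearMap.inr ℝ (E n) (E n))))

/-- Reeb vector field. -/
noncomputable def Zvf (n : ℕ) (_x : M n) : M n := (1, 0, 0)

/-- Hamiltonian vector field of `f`. -/
noncomputable def Xvf (n : ℕ) (f : M n → ℝ) (x : M n) : M n :=
  (0, gradP n f x, - gradQ n f x)

/-- Evaluation vector field of `f`. -/
noncomputable def Yvf (n : ℕ) (f : M n → ℝ) (x : M n) : M n :=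
  Zvf n x + Xvf n f x

/-- The Poisson bracket. -/
noncomputable def pb (n : ℕ) (f g : M n → ℝ) (x : M n) : ℝ :=
  ⟪gradQ n f x, gradP n g x⟫ - ⟪gradP n f x, gradQ n g x⟫

/-- Lie bracket of vector fields. -/
noncomputable def lieBr (n : ℕ) (V W : M n → M n) (x : M n) : M n :=
  fderiv ℝ W x (V x) - fderiv ℝ V x (W x)

/-- The canonical cosymplectic 2-form. -/
noncomputable def ωc (n : ℕ) (u v : M n) : ℝ :=
  ⟪u.2.1, v.2.2⟫ - ⟪v.2.1, u.2.2⟫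

/-- The canonical cosymplectic 1-form. -/
noncomputable def ηc (n : ℕ) (u : M n) : ℝ := u.1

end

/-- The Poisson map from covectors to vectors. -/
noncomputable def Jmap (n : ℕ) : (M n →L[ℝ] ℝ) →L[ℝ] M n :=
  LinearMap.toContinuousLinearMap
    { toFun := fun a => (0,
        (InnerProductSpace.toDual ℝ (E n)).symm
          (a.comp ((ContinuousLinearMap.inr ℝ ℝ (E n × E n)).comp
            (ContinuousLinearMap.inr ℝ (E n) (E n)))),
        - (InnerProductSpace.toDual ℝ (E n)).symm
          (a.comp ((ContinuousLinearMap.inr ℝ ℝ (E n × E n)).comp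
            (ContinuousLinearMap.inl ℝ (E n) (E n)))))
      map_add' := fun a b => by
        simp only [ContinuousLinearMap.add_comp, map_add, Prod.mk_add_mk, neg_add, add_zero]
      map_smul' := fun c a => by
        simp [ContinuousLinearMap.smul_comp] }

theorem Xvf_eq (n : ℕ) (f : M n → ℝ) : Xvf n f = fun x => Jmap n (fderiv ℝ f x) := rfl

theorem apply_J (n : ℕ) (a b : M n →L[ℝ] ℝ) :
    a (Jmap n b) = a (0, (Jmap n b).2.1, 0) + a (0, 0, (Jmap n b).2.2) := by
  rw [← map_add]
  congr 1
  simp [Jmap]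

theorem inner_J1 (n : ℕ) (a : M n →L[ℝ] ℝ) (v : E n) :
    ⟪(Jmap n a).2.1, v⟫ = a (0, 0, v) := by
  simp [Jmap]

theorem inner_J2 (n : ℕ) (a : M n →L[ℝ] ℝ) (v : E n) :
    ⟪(Jmap n a).2.2, v⟫ = - a (0, v, 0) := by
  simp [Jmap]

theorem J_pair (n : ℕ) (a b : M n →L[ℝ] ℝ) :
    a (Jmap n b) = ⟪(Jmap n a).2.1, (Jmap n b).2.2⟫ - ⟪(Jmap n a).2.2, (Jmap n b).2.1⟫ := by
  rw [apply_J, inner_J1, inner_J2]; ring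

theorem J_skew (n : ℕ) (a b : M n →L[ℝ] ℝ) : a (Jmap n b) = - b (Jmap n a) := by
  rw [J_pair, J_pair, real_inner_comm, real_inner_comm (Jmap n b).2.1]; ring

theorem pb_eq (n : ℕ) (f g : M n → ℝ) (x : M n) : pb n f g x = fderiv ℝ f x (Xvf n g x) := by
  have h : pb n f g x = ⟪-(Jmap n (fderiv ℝ f x)).2.2, (Jmap n (fderiv ℝ g x)).2.1⟫
      - ⟪(Jmap n (fderiv ℝ f x)).2.1, -(Jmap n (fderiv ℝ g x)).2.2⟫ := by
    simp only [pb, gradQ, gradP, Jmap, LinearMap.coe_toContinuousLinearMap', LinearMap.coe_mk,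
      AddHom.coe_mk, neg_neg]
  rw [h, Xvf_eq, J_pair, inner_neg_left, inner_neg_right]; ring

theorem key (n : ℕ) (c : M n) (f g : M n → ℝ) (hf : ContDiff ℝ 2 f) (hg : ContDiff ℝ 2 g)
    (h : ∀ x, fderiv ℝ f x (c + Xvf n g x) = 0) (x : M n) :
    lieBr n (fun y => c + Xvf n g y) (Xvf n f) x = 0 := by
  have df : DifferentiableAt ℝ (fderiv ℝ f) x :=
    (hf.fderiv_right (m := 1) (by norm_num)).differentiable (by norm_num) x
  have dg : DifferentiableAt ℝ (fderiv ℝ g) x :=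
    (hg.fderiv_right (m := 1) (by norm_num)).differentiable (by norm_num) x
  have hXf : HasFDerivAt (Xvf n f) ((Jmap n).comp (fderiv ℝ (fderiv ℝ f) x)) x :=
    (Jmap n).hasFDerivAt.comp x df.hasFDerivAt
  have hXg : HasFDerivAt (fun y => c + Xvf n g y)
      ((Jmap n).comp (fderiv ℝ (fderiv ℝ g) x)) x :=
    ((Jmap n).hasFDerivAt.comp x dg.hasFDerivAt).const_add c
  have hs : IsSymmSndFDerivAt ℝ g x := hg.contDiffAt.isSymmSndFDerivAt (by simp)
  have hd := df.hasFDerivAt.clm_apply hXg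
  have hz : (fun y => fderiv ℝ f y (c + Xvf n g y)) = fun _ => 0 := funext h
  rw [hz] at hd
  have h0 := hd.unique (hasFDerivAt_const (0 : ℝ) x)
  have hsf : IsSymmSndFDerivAt ℝ f x := hf.contDiffAt.isSymmSndFDerivAt (by simp)
  rw [lieBr, hXf.fderiv, hXg.fderiv, ContinuousLinearMap.comp_apply,
    ContinuousLinearMap.comp_apply, ← map_sub]
  have : fderiv ℝ (fderiv ℝ f) x (c + Xvf n g x) - fderiv ℝ (fderiv ℝ g) x (Xvf n f x) = 0 := by
    refine ContinuousLinearMap.ext fun w => ?_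
    have hw := DFunLike.congr_fun h0 w
    simp only [ContinuousLinearMap.add_apply, ContinuousLinearMap.comp_apply,
      ContinuousLinearMap.flip_apply, ContinuousLinearMap.zero_apply] at hw
    rw [J_skew] at hw
    rw [ContinuousLinearMap.sub_apply, hsf.eq, hs.eq, ContinuousLinearMap.zero_apply, Xvf_eq n f]
    linarith
  rw [this, map_zero]


/-- the vector fields `Y_H, X_{f₁}, …, X_{f_r}` pairwise commute. -/
theorem symmetry_fields_commute
    (n r : ℕ) (hn : 1 ≤ n) (H : M n → ℝ) (f : Fin r → M n → ℝ)
    (hH : ContDiff ℝ 2 H) (hf : ∀ i, ContDiff ℝ 2 (f i))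
    (hint : ∀ i, ∀ x, dt n (f i) x + pb n (f i) H x = 0)
    (hcomm : ∀ i j, ∀ x, pb n (f i) (f j) x = 0) :
    (∀ i, ∀ x, lieBr n (Yvf n H) (Xvf n (f i)) x = 0) ∧
      (∀ i j, ∀ x, lieBr n (Xvf n (f i)) (Xvf n (f j)) x = 0) := by
  refine ⟨fun i x => ?_, fun i j x => ?_⟩
  · refine key n (1, 0, 0) (f i) H (hf i) hH (fun y => ?_) x
    rw [map_add, ← pb_eq]
    exact hint i y
  · have := key n 0 (f j) (f i) (hf j) (hf i) (fun y => ?_) x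
    · simpa only [zero_add] using this
    · rw [zero_add, ← pb_eq]
      exact hcomm j i y
end

section
/- In the canonical cosymplectic model, let H, f₁, …, f_r : M → ℝ be continuously differentiable, let x₀ ∈ M satisfy ∂fᵢ/∂t(x₀) + {fᵢ, H}(x₀) = 0 for i = 1, …, r, and assume the total Fréchet derivatives df₁(x₀), …, df_r(x₀) are linearly independent. Then the r + 1 vectors Y_H(x₀), X_{f₁}(x₀), …, X_{f_r}(x₀) are linearly independent in ℝ × E × E. -/
open RealInnerProductSpace

/-- `Y_H(x₀), X_{f₁}(x₀), …, X_{f_r}(x₀)` are linearly independent whenever the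
differentials `df₁(x₀), …, df_r(x₀)` are. -/
theorem evaluation_and_hamiltonian_fields_independent
    (n r : ℕ) (hn : 1 ≤ n) (H : M n → ℝ) (f : Fin r → M n → ℝ)
    (hH : ContDiff ℝ 1 H) (hf : ∀ i, ContDiff ℝ 1 (f i)) (x₀ : M n)
    (hint : ∀ i, dt n (f i) x₀ + pb n (f i) H x₀ = 0)
    (hind : LinearIndependent ℝ (fun i : Fin r => fderiv ℝ (f i) x₀)) :
    LinearIndependent ℝ
      (Fin.cons (Yvf n H x₀) (fun i => Xvf n (f i) x₀) : Fin (r + 1) → M n) := by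
  classical
  have key : ∀ (g : M n → ℝ) (t : ℝ) (q p : E n), fderiv ℝ g x₀ (t, q, p)
      = t * dt n g x₀ + ⟪gradQ n g x₀, q⟫ + ⟪gradP n g x₀, p⟫ := by
    intro g t q p
    have h : ((t, q, p) : M n) = t • (1, 0, 0) + (0, q, 0) + (0, 0, p) := by
      simp
    rw [h, map_add, map_add, map_smul]
    simp [dt, gradQ, gradP, InnerProductSpace.toDual_symm_apply]
  rw [Fintype.linearIndependent_iff] at hind ⊢
  intro c hc
  rw [Fin.sum_univ_succ] at hc
  simp only [Fin.cons_zero, Fin.cons_succ] at hc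
  have h0 : c 0 = 0 := by
    have := congrArg Prod.fst hc
    simpa [Yvf, Zvf, Xvf, Prod.fst_sum] using this
  rw [h0, zero_smul, zero_add] at hc
  have hP : ∑ i : Fin r, c i.succ • gradP n (f i) x₀ = 0 := by
    have := congrArg (fun u : M n => u.2.1) hc
    simpa [Xvf, Prod.fst_sum, Prod.snd_sum] using this
  have hQ : ∑ i : Fin r, c i.succ • gradQ n (f i) x₀ = 0 := by
    have := congrArg (fun u : M n => u.2.2) hc
    simpa [Xvf, Prod.fst_sum, Prod.snd_sum] using this
  have hP' : ∀ v : E n, ∑ i : Fin r, c i.succ * ⟪gradP n (f i) x₀, v⟫ = 0 := by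
    intro v
    have := congrArg (fun u : E n => ⟪u, v⟫) hP
    simpa [sum_inner, real_inner_smul_left] using this
  have hQ' : ∀ v : E n, ∑ i : Fin r, c i.succ * ⟪gradQ n (f i) x₀, v⟫ = 0 := by
    intro v
    have := congrArg (fun u : E n => ⟪u, v⟫) hQ
    simpa [sum_inner, real_inner_smul_left] using this
  have hT : ∑ i : Fin r, c i.succ * dt n (f i) x₀ = 0 := by
    have h : ∀ i : Fin r, c i.succ * dt n (f i) x₀ =
        c i.succ * ⟪gradP n (f i) x₀, gradQ n H x₀⟫
          - c i.succ * ⟪gradQ n (f i) x₀, gradP n H x₀⟫ := by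
      intro i
      have := hint i
      unfold pb at this
      linear_combination c i.succ * this
    rw [Finset.sum_congr rfl (fun i _ => h i), Finset.sum_sub_distrib, hP', hQ', sub_zero]
  have hz := hind (fun i => c i.succ) (by
    refine ContinuousLinearMap.ext ?_
    rintro ⟨t, q, p⟩
    simp only [ContinuousLinearMap.sum_apply, ContinuousLinearMap.smul_apply, key, smul_eq_mul,
      ContinuousLinearMap.zero_apply, mul_add, Finset.sum_add_distrib, hP', hQ', add_zero]
    simp only [mul_left_comm _ t, ← Finset.mul_sum, hT, mul_zero])
  intro i
  refine Fin.cases h0 hz i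
end

section
/- In the canonical cosymplectic model, let H : M → ℝ be continuously differentiable and for x ∈ M define the bilinear form Ω'_x(u, v) = ω(u, v) + dH_x(u)·η(v) − dH_x(v)·η(u) (the 2-form ω + dH ∧ η evaluated at x, dH_x being the total Fréchet derivative of H). Then for every x ∈ M, the evaluation vector field value Y_H(x) is the unique vector w ∈ ℝ × E × E satisfying Ω'_x(w, v) = 0 for all v and η(w) = 1; that is, Y_H is the Reeb vector field of the modified cosymplectic structure (ω + dH ∧ η, η). -/
open RealInnerProductSpace

theorem fderiv_split (n : ℕ) (H : M n → ℝ) (x v : M n) :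
    fderiv ℝ H x v = v.1 * dt n H x + ⟪gradQ n H x, v.2.1⟫ + ⟪gradP n H x, v.2.2⟫ := by
  obtain ⟨a, b, c⟩ := v
  have h : ((a, b, c) : M n) = a • ((1, 0, 0) : M n) + ((0, b, 0) : M n) + ((0, 0, c) : M n) := by
    simp
  rw [h, map_add, map_add, map_smul]
  simp [dt, gradQ, gradP, InnerProductSpace.toDual_symm_apply]

/-- `Y_H` is the Reeb vector field of the modified cosymplectic structure
`(ω + dH ∧ η, η)`. -/
theorem evaluation_field_is_modified_reeb
    (n : ℕ) (hn : 1 ≤ n) (H : M n → ℝ) (hH : ContDiff ℝ 1 H) (x : M n) :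
    ∀ w : M n,
      ((∀ v : M n,
          ωc n w v + fderiv ℝ H x w * ηc n v - fderiv ℝ H x v * ηc n w = 0) ∧
        ηc n w = 1) ↔ w = Yvf n H x := by
  intro w
  obtain ⟨a, b, c⟩ := w
  constructor
  · rintro ⟨h, h1⟩
    simp only [ηc] at h1
    subst h1
    have hb : b = gradP n H x := by
      refine ext_inner_right ℝ fun v => ?_
      have := h (0, 0, v)
      rw [fderiv_split n H x (0, 0, v)] at this
      simp [ωc, ηc] at this
      linarith
    have hc : c = - gradQ n H x := by
      refine ext_inner_right ℝ fun v => ?_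
      have := h (0, v, 0)
      rw [fderiv_split n H x (0, v, 0)] at this
      simp [ωc, ηc] at this
      rw [inner_neg_left, real_inner_comm]
      linarith
    simp [Yvf, Zvf, Xvf, hb, hc]
  · intro h
    rw [h]
    refine ⟨fun v => ?_, by simp [Yvf, Zvf, Xvf, ηc]⟩
    rw [fderiv_split n H x v, fderiv_split n H x (Yvf n H x)]
    simp only [Yvf, Zvf, Xvf, ηc, ωc, Prod.mk_add_mk, zero_add, add_zero, inner_neg_right]
    rw [real_inner_comm (gradQ n H x) (gradP n H x), real_inner_comm (gradQ n H x) v.2.1]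
    ring
end

section
/- In the canonical cosymplectic model, let H, f : M → ℝ be continuously differentiable and for x ∈ M define Ω'_x(u, v) = ω(u, v) + dH_x(u)·η(v) − dH_x(v)·η(u). Then for every x ∈ M, X_f(x) is the unique vector w ∈ ℝ × E × E satisfying Ω'_x(w, v) = df_x(v) − ((∂f/∂t)(x) + {f, H}(x))·η(v) for all v and η(w) = 0. (Equivalently: the Hamiltonian vector field of f with respect to the modified cosymplectic structure (ω + dH ∧ η, η), whose Reeb vector field is Y_H, coincides with X_f.) -/
open RealInnerProductSpace

/-- Decomposition of the differential through the partial gradients. -/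
theorem fderiv_decomp (n : ℕ) (f : M n → ℝ) (x v : M n) :
    fderiv ℝ f x v = dt n f x * v.1 + ⟪gradQ n f x, v.2.1⟫ + ⟪gradP n f x, v.2.2⟫ := by
  obtain ⟨t, q, p⟩ := v
  have h : ((t, q, p) : M n) = t • ((1, 0, 0) : M n) + (0, q, 0) + (0, 0, p) := by
    simp
  have hq : ⟪gradQ n f x, q⟫ = fderiv ℝ f x (0, q, 0) := by
    simp [gradQ]
  have hp : ⟪gradP n f x, p⟫ = fderiv ℝ f x (0, 0, p) := by
    simp [gradP]
  simp only [hq, hp, dt]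
  rw [h, map_add, map_add, map_smul, smul_eq_mul]
  ring

/-- the Hamiltonian vector field of `f` with respect to the modified
cosymplectic structure `(ω + dH ∧ η, η)` coincides with `X_f`. -/
theorem modified_hamiltonian_field_eq
    (n : ℕ) (hn : 1 ≤ n) (H f : M n → ℝ)
    (hH : ContDiff ℝ 1 H) (hf : ContDiff ℝ 1 f) (x : M n) :
    ∀ w : M n,
      ((∀ v : M n,
          ωc n w v + fderiv ℝ H x w * ηc n v - fderiv ℝ H x v * ηc n w =
            fderiv ℝ f x v - (dt n f x + pb n f H x) * ηc n v) ∧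
        ηc n w = 0) ↔ w = Xvf n f x := by
  intro w
  constructor
  · rintro ⟨h, h0⟩
    obtain ⟨t, q, p⟩ := w
    simp only [ηc] at h0
    subst h0
    have hq : q = gradP n f x := by
      refine ext_inner_right ℝ fun v => ?_
      have := h (0, 0, v)
      rw [fderiv_decomp n f] at this
      simpa [ωc, ηc] using this
    have hp : p = - gradQ n f x := by
      refine ext_inner_right ℝ fun v => ?_
      have := h (0, v, 0)
      rw [fderiv_decomp n f] at this
      simp [ωc, ηc] at this
      rw [inner_neg_left, real_inner_comm, ← this, neg_neg]
    rw [hq, hp, Xvf]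
  · rintro rfl
    refine ⟨fun v => ?_, rfl⟩
    rw [fderiv_decomp n f, fderiv_decomp n H x (Xvf n f x)]
    simp only [ωc, ηc, Xvf, pb, inner_neg_right]
    rw [real_inner_comm (gradQ n f x) v.2.1, real_inner_comm (gradP n f x) (gradQ n H x),
      real_inner_comm (gradQ n f x) (gradP n H x)]
    ring
end

section
/- In the canonical cosymplectic model (so dim M = 2n + 1), let f₁, …, f_m : M → ℝ be continuously differentiable, let 0 ≤ r ≤ m with m + r = 2n, and let x ∈ M be a point at which ∂fᵢ/∂t(x) = 0 for i = 1, …, m, {fᵢ, fⱼ}(x) = 0 for all i = 1, …, r and j = 1, …, m, and the total Fréchet derivatives df₁(x), …, df_m(x) are linearly independent. Then the ω-orthogonal of P_x = span{Z(x), X_{f₁}(x), …, X_{f_r}(x)} equals Q_x = span{Z(x), X_{f₁}(x), …, X_{f_m}(x)}: {v ∈ ℝ × E × E : ω(v, w) = 0 for all w ∈ P_x} = Q_x. In particular P_x is isotropic and Q_x is coisotropic with respect to ω. -/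
open RealInnerProductSpace

theorem dec_aux (n : ℕ) (f : M n → ℝ) (x v : M n) (h : dt n f x = 0) :
    fderiv ℝ f x v = ⟪gradQ n f x, v.2.1⟫ + ⟪gradP n f x, v.2.2⟫ := by
  unfold gradQ gradP
  unfold dt at h
  rw [InnerProductSpace.toDual_symm_apply, InnerProductSpace.toDual_symm_apply]
  have hv : v = v.1 • ((1, 0, 0) : M n) + ((0, v.2.1, 0) + (0, 0, v.2.2)) := by
    ext <;> simp
  conv_lhs => rw [hv]
  rw [map_add, map_add, map_smul, h]
  simp

noncomputable def omB (n : ℕ) : M n →ₗ[ℝ] M n →ₗ[ℝ] ℝ :=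
  LinearMap.mk₂ ℝ (ωc n)
    (by intro a b c; simp only [ωc, Prod.snd_add, Prod.fst_add, inner_add_left, inner_add_right]; ring)
    (by intro a b c; simp only [ωc, Prod.smul_snd, Prod.smul_fst, inner_smul_left, inner_smul_right]; simp; ring)
    (by intro a b c; simp only [ωc, Prod.snd_add, Prod.fst_add, inner_add_left, inner_add_right]; ring)
    (by intro a b c; simp only [ωc, Prod.smul_snd, Prod.smul_fst, inner_smul_left, inner_smul_right]; simp; ring)

theorem omB_apply (n : ℕ) (u v : M n) : omB n u v = ωc n u v := rfl

theorem om_X (n : ℕ) (f : M n → ℝ) (x v : M n) (h : dt n f x = 0) :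
    ωc n v (Xvf n f x) = - fderiv ℝ f x v := by
  rw [dec_aux n f x v h]
  simp only [ωc, Xvf, inner_neg_right, real_inner_comm]
  rw [real_inner_comm]
  ring

theorem om_Z (n : ℕ) (x v : M n) : ωc n v (Zvf n x) = 0 := by
  simp [ωc, Zvf]

theorem om_XX (n : ℕ) (f g : M n → ℝ) (x : M n) :
    ωc n (Xvf n g x) (Xvf n f x) = - pb n f g x := by
  simp only [ωc, Xvf, pb, inner_neg_right]
  rw [real_inner_comm (gradQ n f x)]
  ring

theorem om_span (n : ℕ) (x v : M n) {k : ℕ} (X : Fin k → M n) :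
    (∀ w ∈ Submodule.span ℝ (insert (Zvf n x) (Set.range X)), ωc n v w = 0) ↔
      ∀ i, ωc n v (X i) = 0 := by
  constructor
  · intro h i
    exact h _ (Submodule.subset_span (Or.inr ⟨i, rfl⟩))
  · intro h w hw
    have : Submodule.span ℝ (insert (Zvf n x) (Set.range X)) ≤ LinearMap.ker (omB n v) := by
      rw [Submodule.span_le]
      rintro y (rfl | ⟨i, rfl⟩)
      · exact om_Z n x v
      · exact h i
    exact this hw

/-- at a point where the integrals are independent, in involution with the
first `r` of them, and time-independent, the `ω`-orthogonal of
`P_x = span{Z(x), X_{f₁}(x), …, X_{f_r}(x)}` equals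
`Q_x = span{Z(x), X_{f₁}(x), …, X_{f_m}(x)}`; in particular `P_x` is isotropic and
`Q_x` is coisotropic. -/
theorem orthogonal_of_P_eq_Q
    (n m r : ℕ) (hn : 1 ≤ n) (hr : r ≤ m) (hmr : m + r = 2 * n)
    (f : Fin m → M n → ℝ) (hf : ∀ j, ContDiff ℝ 1 (f j)) (x : M n)
    (hdt : ∀ j, dt n (f j) x = 0)
    (hpb : ∀ (i : Fin r) (j : Fin m), pb n (f (Fin.castLE hr i)) (f j) x = 0)
    (hind : LinearIndependent ℝ (fun j : Fin m => fderiv ℝ (f j) x)) :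
    ({v : M n | ∀ w ∈ Submodule.span ℝ
        (insert (Zvf n x) (Set.range fun i : Fin r => Xvf n (f (Fin.castLE hr i)) x)),
        ωc n v w = 0} =
      (Submodule.span ℝ
        (insert (Zvf n x) (Set.range fun j : Fin m => Xvf n (f j) x)) : Set (M n))) ∧
    (∀ u ∈ Submodule.span ℝ
        (insert (Zvf n x) (Set.range fun i : Fin r => Xvf n (f (Fin.castLE hr i)) x)),
      ∀ w ∈ Submodule.span ℝ
        (insert (Zvf n x) (Set.range fun i : Fin r => Xvf n (f (Fin.castLE hr i)) x)),
        ωc n u w = 0) ∧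
    ({v : M n | ∀ w ∈ Submodule.span ℝ
        (insert (Zvf n x) (Set.range fun j : Fin m => Xvf n (f j) x)),
        ωc n v w = 0} ⊆
      (Submodule.span ℝ
        (insert (Zvf n x) (Set.range fun j : Fin m => Xvf n (f j) x)) : Set (M n))) := by
  have hli : LinearIndependent ℝ
      (fun j : Fin m => ((fderiv ℝ (f j) x : M n →L[ℝ] ℝ) : M n →ₗ[ℝ] ℝ)) :=
    hind.map' (ContinuousLinearMap.coeLM ℝ)
      (LinearMap.ker_eq_bot.2 ContinuousLinearMap.coe_injective)
  have hX : LinearIndependent ℝ (fun j : Fin m => Xvf n (f j) x) := by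
    apply LinearIndependent.of_comp (-(omB n).flip)
    convert hli using 1
    ext1 j
    apply LinearMap.ext
    intro v
    simp [omB_apply, om_X n (f j) x v (hdt j)]
  have hZX : LinearIndependent ℝ
      (Fin.cons (Zvf n x) (fun j : Fin m => Xvf n (f j) x) : Fin (m + 1) → M n) := by
    rw [linearIndependent_finCons]
    refine ⟨hX, fun hmem => ?_⟩
    have hle : Submodule.span ℝ (Set.range fun j : Fin m => Xvf n (f j) x) ≤
        LinearMap.ker (LinearMap.fst ℝ ℝ (E n × E n)) := by
      rw [Submodule.span_le]
      rintro y ⟨i, rfl⟩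
      simp [Xvf]
    have := hle hmem
    simp [Zvf] at this
  have hQ := finrank_span_eq_card hZX
  rw [Fin.range_cons, Fintype.card_fin] at hQ
  have hlir : LinearIndependent ℝ
      (fun i : Fin r => ((fderiv ℝ (f (Fin.castLE hr i)) x : M n →L[ℝ] ℝ) : M n →ₗ[ℝ] ℝ)) :=
    hli.comp (Fin.castLE hr) (Fin.castLE_injective hr)
  have hS := finrank_span_eq_card hlir
  rw [Fintype.card_fin] at hS
  set S : Subspace ℝ (Module.Dual ℝ (M n)) := Submodule.span ℝ (Set.range
    (fun i : Fin r => ((fderiv ℝ (f (Fin.castLE hr i)) x : M n →L[ℝ] ℝ) : M n →ₗ[ℝ] ℝ))) with hSdef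
  have hdim := Subspace.finrank_add_finrank_dualCoannihilator_eq S
  have hM : Module.finrank ℝ (M n) = 2 * n + 1 := by
    simp [M, E]; ring
  have hmem : ∀ v : M n, v ∈ S.dualCoannihilator ↔
      ∀ i : Fin r, ωc n v (Xvf n (f (Fin.castLE hr i)) x) = 0 := by
    intro v
    rw [Submodule.mem_dualCoannihilator]
    constructor
    · intro h i
      rw [om_X n _ x v (hdt _), neg_eq_zero]
      exact h _ (Submodule.subset_span ⟨i, rfl⟩)
    · intro h φ hφ
      have hle : S ≤ LinearMap.ker (Module.Dual.eval ℝ (M n) v) := by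
        rw [hSdef, Submodule.span_le]
        rintro y ⟨i, rfl⟩
        have := h i
        rw [om_X n _ x v (hdt _), neg_eq_zero] at this
        simpa using this
      simpa using hle hφ
  have hle : Submodule.span ℝ (insert (Zvf n x) (Set.range fun j : Fin m => Xvf n (f j) x)) ≤
      S.dualCoannihilator := by
    rw [Submodule.span_le]
    rintro y (rfl | ⟨j, rfl⟩)
    · refine (hmem _).2 fun i => ?_
      rw [om_X n _ x _ (hdt _), neg_eq_zero]
      exact hdt _
    · refine (hmem _).2 fun i => ?_
      dsimp only
      rw [om_XX, hpb, neg_zero]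
  have hdim2 : r + Module.finrank ℝ S.dualCoannihilator = 2 * n + 1 := by
    rw [← hM, ← hdim]
    exact congrArg (· + _) hS.symm
  have heq := Submodule.eq_of_le_of_finrank_eq hle (by rw [hQ]; omega)
  have h1 : ∀ v : M n, (∀ w ∈ Submodule.span ℝ
        (insert (Zvf n x) (Set.range fun i : Fin r => Xvf n (f (Fin.castLE hr i)) x)),
        ωc n v w = 0) ↔ v ∈ Submodule.span ℝ
        (insert (Zvf n x) (Set.range fun j : Fin m => Xvf n (f j) x)) := by
    intro v
    rw [om_span, heq, hmem]
  have hPQ : Submodule.span ℝ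
        (insert (Zvf n x) (Set.range fun i : Fin r => Xvf n (f (Fin.castLE hr i)) x)) ≤
      Submodule.span ℝ
        (insert (Zvf n x) (Set.range fun j : Fin m => Xvf n (f j) x)) := by
    apply Submodule.span_mono
    apply Set.insert_subset_insert
    rintro y ⟨i, rfl⟩
    exact ⟨Fin.castLE hr i, rfl⟩
  refine ⟨Set.ext h1, fun u hu => (h1 u).2 (hPQ hu), fun v hv => (h1 v).1 fun w hw => hv w (hPQ hw)⟩
end

section
/- In the canonical cosymplectic model, let f₁, …, f_m : M → ℝ be continuously differentiable and let x ∈ M be a point at which ∂fᵢ/∂t(x) = 0 for i = 1, …, m and the total Fréchet derivatives df₁(x), …, df_m(x) are linearly independent. Then the m + 1 vectors Z(x), X_{f₁}(x), …, X_{f_m}(x) are linearly independent in ℝ × E × E. -/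
open RealInnerProductSpace

theorem fderiv_expand (n : ℕ) (f : M n → ℝ) (x v : M n) :
    fderiv ℝ f x v = v.1 * dt n f x + ⟪gradQ n f x, v.2.1⟫ + ⟪gradP n f x, v.2.2⟫ := by
  have h : v = v.1 • ((1, 0, 0) : M n) + (0, v.2.1, 0) + (0, 0, v.2.2) := by
    ext <;> simp
  conv_lhs => rw [h]
  rw [map_add, map_add, map_smul]
  simp [dt, gradQ, gradP]

/-- `Z(x), X_{f₁}(x), …, X_{f_m}(x)` are linearly independent whenever the
differentials `df₁(x), …, df_m(x)` are and `∂fᵢ/∂t(x) = 0`. -/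
theorem reeb_and_hamiltonian_fields_independent
    (n m : ℕ) (hn : 1 ≤ n) (f : Fin m → M n → ℝ)
    (hf : ∀ j, ContDiff ℝ 1 (f j)) (x : M n)
    (hdt : ∀ j, dt n (f j) x = 0)
    (hind : LinearIndependent ℝ (fun j : Fin m => fderiv ℝ (f j) x)) :
    LinearIndependent ℝ
      (Fin.cons (Zvf n x) (fun j => Xvf n (f j) x) : Fin (m + 1) → M n) := by
  rw [Fintype.linearIndependent_iff] at hind ⊢
  intro g hg
  rw [Fin.sum_univ_succ] at hg
  simp only [Fin.cons_zero, Fin.cons_succ] at hg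
  have h1 := congrArg (fun v : M n => v.1) hg
  have h2 := congrArg (fun v : M n => v.2.1) hg
  have h3 := congrArg (fun v : M n => v.2.2) hg
  simp [Zvf, Xvf, Prod.fst_sum, Prod.snd_sum] at h1 h2 h3
  have key := hind (fun j => g j.succ) (by
    refine ContinuousLinearMap.ext fun v => ?_
    have e2 := congrArg (fun w : E n => ⟪w, v.2.2⟫) h2
    have e3 := congrArg (fun w : E n => ⟪w, v.2.1⟫) h3
    simp only [sum_inner, real_inner_smul_left, inner_zero_left] at e2 e3
    rw [ContinuousLinearMap.sum_apply]
    simp only [ContinuousLinearMap.smul_apply, fderiv_expand, hdt, smul_eq_mul, mul_zero,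
      zero_add, mul_add, Finset.sum_add_distrib, e2, e3, add_zero,
      ContinuousLinearMap.zero_apply])
  intro i
  refine Fin.cases h1 key i
end
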